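/- arXiv:1711.05096 — 2 statements merged into one kernel-verified Lean document; each statement's English description precedes it below -/
import Mathlib

section
/- There exists a finite family P₁, …, P_N of axis-aligned 2-bend paths such that Pᵢ ∩ Pⱼ is infinite for all i ≠ j (so the corresponding vertices form a clique in the represented graph), yet there do not exist two closed segments s and t of positive length such that every Pᵢ contains s or contains t. In other words, a clique in a 2-bend EPG representation need not be contained in the union of two edge-cliques. -/
open Set

/-- Two points span an axis-parallel segment (same x or same y). -/
def AxisParallel (p q : ℝ × ℝ) : Prop := p.1 = q.1 ∨ p.2 = q.2

/-- Segment `p q` and segment `q r` are axis-parallel and mutually perpendicular. -/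
def Perp (p q r : ℝ × ℝ) : Prop :=
  (p.1 = q.1 ∧ q.2 = r.2) ∨ (p.2 = q.2 ∧ q.1 = r.1)

/-- An axis-aligned 2-bend path: a union of at most three closed segments of positive
length, each axis-parallel, consecutive ones sharing an endpoint and perpendicular. -/
def IsAA2BendPath (P : Set (ℝ × ℝ)) : Prop :=
  (∃ p q : ℝ × ℝ, p ≠ q ∧ AxisParallel p q ∧ P = segment ℝ p q) ∨
  (∃ p q r : ℝ × ℝ, p ≠ q ∧ q ≠ r ∧ Perp p q r ∧
    P = segment ℝ p q ∪ segment ℝ q r) ∨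
  (∃ p q r s : ℝ × ℝ, p ≠ q ∧ q ≠ r ∧ r ≠ s ∧ Perp p q r ∧ Perp q r s ∧
    P = segment ℝ p q ∪ segment ℝ q r ∪ segment ℝ r s)

/-- An axis-aligned 2-bend EPG representation of a graph. -/
def IsAA2BendEPG {V : Type*} (G : SimpleGraph V) (f : V → Set (ℝ × ℝ)) : Prop :=
  (∀ v, IsAA2BendPath (f v)) ∧
  ∀ u v : V, u ≠ v → (G.Adj u v ↔ (f u ∩ f v).Infinite)

/-- A maximal clique of a graph. -/
def MaximalClique {V : Type*} (G : SimpleGraph V) (s : Set V) : Prop :=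
  G.IsClique s ∧ ∀ t : Set V, G.IsClique t → s ⊆ t → t = s

/-- A closed segment of positive length. -/
def IsSeg (s : Set (ℝ × ℝ)) : Prop := ∃ p q : ℝ × ℝ, p ≠ q ∧ s = segment ℝ p q

lemma mem_vseg (x a b : ℝ) (z : ℝ × ℝ) :
    z ∈ segment ℝ (x, a) (x, b) ↔ z.1 = x ∧ ((a ≤ z.2 ∧ z.2 ≤ b) ∨ (b ≤ z.2 ∧ z.2 ≤ a)) := by
  rw [← Prod.image_mk_segment_right, segment_eq_uIcc]
  obtain ⟨u, v⟩ := z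
  simp only [mem_image, Prod.mk.injEq, mem_uIcc]
  constructor
  · rintro ⟨y, hy, rfl, rfl⟩
    exact ⟨rfl, hy⟩
  · rintro ⟨rfl, h⟩
    exact ⟨v, h, rfl, rfl⟩

lemma mem_hseg (y a b : ℝ) (z : ℝ × ℝ) :
    z ∈ segment ℝ (a, y) (b, y) ↔ z.2 = y ∧ ((a ≤ z.1 ∧ z.1 ≤ b) ∨ (b ≤ z.1 ∧ z.1 ≤ a)) := by
  rw [← Prod.image_mk_segment_left, segment_eq_uIcc]
  obtain ⟨u, v⟩ := z
  simp only [mem_image, Prod.mk.injEq, mem_uIcc]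
  constructor
  · rintro ⟨y, hy, rfl, rfl⟩
    exact ⟨rfl, hy⟩
  · rintro ⟨rfl, h⟩
    exact ⟨u, h, rfl, rfl⟩

/-- The path through `(x₁,e₁)`, `(x₁,y)`, `(x₂,y)`, `(x₂,e₂)`. -/
def zPath (x₁ x₂ y e₁ e₂ : ℝ) : Set (ℝ × ℝ) :=
  segment ℝ (x₁, e₁) (x₁, y) ∪ segment ℝ (x₁, y) (x₂, y) ∪ segment ℝ (x₂, y) (x₂, e₂)

lemma zPath_isPath {x₁ x₂ y e₁ e₂ : ℝ} (h : x₁ ≠ x₂) (h₁ : e₁ ≠ y) (h₂ : y ≠ e₂) :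
    IsAA2BendPath (zPath x₁ x₂ y e₁ e₂) := by
  refine Or.inr (Or.inr ⟨(x₁, e₁), (x₁, y), (x₂, y), (x₂, e₂), ?_, ?_, ?_, ?_, ?_, rfl⟩)
  · simpa using h₁
  · simpa using h
  · simpa using h₂
  · exact Or.inl ⟨rfl, rfl⟩
  · exact Or.inr ⟨rfl, rfl⟩

lemma mem_zPath (x₁ x₂ y e₁ e₂ : ℝ) (z : ℝ × ℝ) :
    z ∈ zPath x₁ x₂ y e₁ e₂ ↔
      (z.1 = x₁ ∧ ((e₁ ≤ z.2 ∧ z.2 ≤ y) ∨ (y ≤ z.2 ∧ z.2 ≤ e₁))) ∨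
      (z.2 = y ∧ ((x₁ ≤ z.1 ∧ z.1 ≤ x₂) ∨ (x₂ ≤ z.1 ∧ z.1 ≤ x₁))) ∨
      (z.1 = x₂ ∧ ((y ≤ z.2 ∧ z.2 ≤ e₂) ∨ (e₂ ≤ z.2 ∧ z.2 ≤ y))) := by
  simp only [zPath, mem_union, mem_vseg, mem_hseg, or_assoc]

lemma infinite_of_vert {S : Set (ℝ × ℝ)} (x a : ℝ)
    (h : ∀ y, a ≤ y → y ≤ a + 1 → (x, y) ∈ S) : S.Infinite := by
  have h1 : ((fun y : ℝ => (x, y)) '' Icc a (a + 1)).Infinite :=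
    (Icc_infinite (by linarith)).image (fun u _ v _ huv => (Prod.mk.inj huv).2)
  refine h1.mono ?_
  rintro _ ⟨y, hy, rfl⟩
  exact h y hy.1 hy.2

lemma seg_infinite {s : Set (ℝ × ℝ)} (hs : IsSeg s) : s.Infinite := by
  obtain ⟨p, q, hpq, rfl⟩ := hs
  rw [segment_eq_image_lineMap]
  exact (Icc_infinite one_pos).image (AffineMap.lineMap_injective ℝ hpq).injOn

lemma seg_generic {s : Set (ℝ × ℝ)} (hs : IsSeg s) :
    ∃ z ∈ s, ¬ ((z.1 = 1 ∨ z.1 = 2 ∨ z.1 = 3) ∧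
      (z.2 = -1 ∨ z.2 = -2 ∨ z.2 = -3 ∨ z.2 = 2 ∨ z.2 = 3 ∨ z.2 = 4)) := by
  have hf : ((({1, 2, 3} : Set ℝ) ×ˢ ({-1, -2, -3, 2, 3, 4} : Set ℝ)) : Set (ℝ × ℝ)).Finite :=
    (toFinite _).prod (toFinite _)
  obtain ⟨z, hz, hn⟩ := (seg_infinite hs).exists_notMem_finite hf
  exact ⟨z, hz, by simpa [mem_prod] using hn⟩

/-- The six paths. -/
def thePaths : Fin 6 → Set (ℝ × ℝ) :=
  ![zPath 1 2 (-1) 0 10, zPath 1 2 2 1 (-10),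
    zPath 3 1 (-2) 0 10, zPath 3 1 3 1 (-10),
    zPath 2 3 (-3) 0 10, zPath 2 3 4 1 (-10)]

lemma generic_hits (z : ℝ × ℝ) (hz : ¬ ((z.1 = 1 ∨ z.1 = 2 ∨ z.1 = 3) ∧
      (z.2 = -1 ∨ z.2 = -2 ∨ z.2 = -3 ∨ z.2 = 2 ∨ z.2 = 3 ∨ z.2 = 4))) :
    (z ∉ thePaths 4 ∧ z ∉ thePaths 5 ∧ ¬ (z ∈ thePaths 0 ∧ z ∈ thePaths 1)) ∨
    (z ∉ thePaths 2 ∧ z ∉ thePaths 3 ∧ ¬ (z ∈ thePaths 4 ∧ z ∈ thePaths 5)) ∨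
    (z ∉ thePaths 0 ∧ z ∉ thePaths 1 ∧ ¬ (z ∈ thePaths 2 ∧ z ∈ thePaths 3)) := by
  simp only [thePaths, Matrix.cons_val, mem_zPath]
  obtain ⟨x, y⟩ := z
  simp only at hz ⊢
  by_cases h1 : x = 1
  · subst h1
    left
    grind
  by_cases h2 : x = 2
  · subst h2
    right; left
    grind
  by_cases h3 : x = 3
  · subst h3
    right; right
    grind
  simp only [h1, h2, h3, false_and, false_or, or_false]
  by_cases h4 : y = -3 ∨ y = 4
  · right; left
    grind
  · left
    grind

lemma pair_infinite_lt (i j : Fin 6) (h : i < j) : (thePaths i ∩ thePaths j).Infinite := by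
  have key : ∃ x : ℝ, ∃ a : ℝ, ∀ y, a ≤ y → y ≤ a + 1 → (x, y) ∈ thePaths i ∩ thePaths j := by
    fin_cases i <;> fin_cases j <;> first
      | (exfalso; revert h; decide)
      | (simp only [thePaths, mem_inter_iff, mem_zPath, Fin.reduceFinMk, Fin.zero_eta, Fin.mk_one,
          Matrix.cons_val]
         clear h
         first
          | (refine ⟨1, -1, fun y h1 h2 => ?_⟩; norm_num; constructor <;> grind)
          | (refine ⟨2, -1, fun y h1 h2 => ?_⟩; norm_num; constructor <;> grind)
          | (refine ⟨3, -1, fun y h1 h2 => ?_⟩; norm_num; constructor <;> grind)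
          | (refine ⟨1, 1, fun y h1 h2 => ?_⟩; norm_num; constructor <;> grind)
          | (refine ⟨2, 1, fun y h1 h2 => ?_⟩; norm_num; constructor <;> grind)
          | (refine ⟨3, 1, fun y h1 h2 => ?_⟩; norm_num; constructor <;> grind))
  obtain ⟨x, a, hk⟩ := key
  exact infinite_of_vert x a hk

/-- A clique in a 2-bend EPG representation need not be contained in the union of two
edge-cliques: there is a family of pairwise adjacent 2-bend paths such that no two
segments `s`, `t` satisfy that every path of the family contains `s` or contains `t`. -/
theorem stmt9 :
    ∃ (N : ℕ) (P : Fin N → Set (ℝ × ℝ)),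
      (∀ i, IsAA2BendPath (P i)) ∧
      (∀ i j, i ≠ j → (P i ∩ P j).Infinite) ∧
      ¬ ∃ s t : Set (ℝ × ℝ), IsSeg s ∧ IsSeg t ∧
          ∀ i, s ⊆ P i ∨ t ⊆ P i := by
  refine ⟨6, thePaths, ?_, ?_, ?_⟩
  · intro i
    fin_cases i <;> exact zPath_isPath (by norm_num) (by norm_num) (by norm_num)
  · intro i j hij
    rcases lt_or_gt_of_ne hij with h | h
    · exact pair_infinite_lt i j h
    · rw [inter_comm]
      exact pair_infinite_lt j i h
  · rintro ⟨s, t, hs, ht, h⟩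
    obtain ⟨z, hzs, hz⟩ := seg_generic hs
    obtain ⟨w, hwt, hw⟩ := seg_generic ht
    have hh : ∀ i, z ∈ thePaths i ∨ w ∈ thePaths i := fun i =>
      (h i).imp (fun k => k hzs) (fun k => k hwt)
    have h0 := hh 0
    have h1 := hh 1
    have h2 := hh 2
    have h3 := hh 3
    have h4 := hh 4
    have h5 := hh 5
    have hz' := generic_hits z hz
    have hw' := generic_hits w hw
    clear hh h hz hw
    generalize thePaths 0 = A at *
    generalize thePaths 1 = A' at *
    generalize thePaths 2 = B at *
    generalize thePaths 3 = B' at *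
    generalize thePaths 4 = C at *
    generalize thePaths 5 = C' at *
    grind
end

section
/- For every positive integer s, the complete bipartite graph K_{2,s} admits an unaligned 1-bend EPG representation if and only if s ≤ 8. -/
open Set

/-- An unaligned 1-bend path: a union of at most two closed segments of positive length
sharing an endpoint and not collinear (arbitrary slopes allowed). -/
def IsUn1BendPath (P : Set (ℝ × ℝ)) : Prop :=
  (∃ p q : ℝ × ℝ, p ≠ q ∧ P = segment ℝ p q) ∨
  (∃ p q r : ℝ × ℝ, p ≠ q ∧ q ≠ r ∧ ¬ Collinear ℝ ({p, q, r} : Set (ℝ × ℝ)) ∧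
    P = segment ℝ p q ∪ segment ℝ q r)

/-- An unaligned 1-bend EPG representation of a graph. -/
def IsUn1BendEPG {V : Type*} (G : SimpleGraph V) (f : V → Set (ℝ × ℝ)) : Prop :=
  (∀ v, IsUn1BendPath (f v)) ∧
  ∀ u v : V, u ≠ v → (G.Adj u v ↔ (f u ∩ f v).Infinite)

/-- planar cross product -/
def crs {R : Type*} [Mul R] [Sub R] (u v : R × R) : R := u.1 * v.2 - u.2 * v.1

lemma inf_iff_nontriv {S T : Set (ℝ × ℝ)} (hS : Convex ℝ S) (hT : Convex ℝ T) :
    (S ∩ T).Infinite ↔ (S ∩ T).Nontrivial :=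
  ⟨fun h => h.nontrivial, fun h => (hS.inter hT).isPreconnected.infinite_of_nontrivial h⟩

lemma crs_zero {d w : ℝ × ℝ} (hd : d ≠ 0) (h : crs d w = 0) : ∃ t : ℝ, w = t • d := by
  obtain ⟨a, b⟩ := d
  obtain ⟨x, y⟩ := w
  simp only [crs] at h
  by_cases ha : a = 0
  · have hb : b ≠ 0 := by
      rintro rfl
      exact hd (by simp [ha])
    refine ⟨y / b, ?_⟩
    ext
    · simp only [Prod.smul_mk, smul_eq_mul]
      field_simp
      linarith
    · simp only [Prod.smul_mk, smul_eq_mul]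
      field_simp
  · refine ⟨x / a, ?_⟩
    ext
    · simp only [Prod.smul_mk, smul_eq_mul]
      field_simp
    · simp only [Prod.smul_mk, smul_eq_mul]
      field_simp
      linarith

lemma mem_seg {x y u : ℝ × ℝ} (h : u ∈ segment ℝ x y) :
    ∃ t : ℝ, 0 ≤ t ∧ t ≤ 1 ∧ u.1 = x.1 + t * (y.1 - x.1) ∧ u.2 = x.2 + t * (y.2 - x.2) := by
  rw [segment_eq_image'] at h
  obtain ⟨t, ⟨h0, h1⟩, rfl⟩ := h
  exact ⟨t, h0, h1, by simp, by simp⟩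

lemma seg_line {x y u v w z : ℝ × ℝ} (hu : u ∈ segment ℝ x y) (hv : v ∈ segment ℝ x y)
    (hw : w ∈ segment ℝ x y) (hz : z ∈ segment ℝ x y) : crs (v - u) (w - z) = 0 := by
  obtain ⟨a, -, -, a1, a2⟩ := mem_seg hu
  obtain ⟨b, -, -, b1, b2⟩ := mem_seg hv
  obtain ⟨c, -, -, c1, c2⟩ := mem_seg hw
  obtain ⟨e, -, -, e1, e2⟩ := mem_seg hz
  simp only [crs, Prod.fst_sub, Prod.snd_sub, a1, a2, b1, b2, c1, c2, e1, e2]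
  ring

lemma crs_of_collinear {p q r : ℝ × ℝ} (h : Collinear ℝ ({p, q, r} : Set (ℝ × ℝ))) :
    crs (p - q) (r - q) = 0 := by
  rw [collinear_iff_of_mem (p₀ := q) (by simp)] at h
  obtain ⟨v, hv⟩ := h
  obtain ⟨a, ha⟩ := hv p (by simp)
  obtain ⟨b, hb⟩ := hv r (by simp)
  rw [ha, hb]
  simp only [crs, vadd_eq_add, add_sub_cancel_right, Prod.smul_fst, Prod.smul_snd, smul_eq_mul]
  ring

lemma collinear_of_crs {p q r : ℝ × ℝ} (hpq : p ≠ q) (h : crs (p - q) (r - q) = 0) :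
    Collinear ℝ ({p, q, r} : Set (ℝ × ℝ)) := by
  obtain ⟨t, ht⟩ := crs_zero (sub_ne_zero.2 hpq) h
  rw [collinear_iff_of_mem (p₀ := q) (by simp)]
  refine ⟨p - q, ?_⟩
  rintro z (rfl | rfl | rfl)
  · exact ⟨1, by simp⟩
  · exact ⟨0, by simp⟩
  · exact ⟨t, by rw [← ht]; simp⟩

/-- lines through two points of a nontrivial intersection -/
lemma nontriv_line {x y z w : ℝ × ℝ} (hxy : x ≠ y)
    (h : (segment ℝ x y ∩ segment ℝ z w).Nontrivial) {u v : ℝ × ℝ}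
    (hu : u ∈ segment ℝ x y) (hv : v ∈ segment ℝ z w) : crs (y - x) (v - u) = 0 := by
  obtain ⟨m, ⟨m1, m2⟩, n, ⟨n1, n2⟩, hmn⟩ := h
  have hx := left_mem_segment ℝ x y
  have hy := right_mem_segment ℝ x y
  have h1 := seg_line hx hy hu m1
  have h2 := seg_line hx hy n1 m1
  have h3 := seg_line m2 n2 hv m2
  obtain ⟨t, ht⟩ := crs_zero (sub_ne_zero.2 hxy.symm) h2
  obtain ⟨s, hs⟩ := crs_zero (sub_ne_zero.2 hmn.symm) h3
  have e : v - u = (s * t) • (y - x) - (u - m) := by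
    rw [mul_smul, ← ht, ← hs]; abel
  rw [e]
  simp only [crs, Prod.fst_sub, Prod.snd_sub, Prod.smul_fst, Prod.smul_snd, smul_eq_mul] at h1 ⊢
  linarith

lemma path_norm {P : Set (ℝ × ℝ)} (h : IsUn1BendPath P) :
    ∃ p q r : ℝ × ℝ, p ≠ q ∧ q ≠ r ∧ P = segment ℝ p q ∪ segment ℝ q r ∧
      (p = r ∨ crs (p - q) (r - q) ≠ 0) := by
  rcases h with ⟨p, q, hpq, rfl⟩ | ⟨p, q, r, hpq, hqr, hc, rfl⟩
  · exact ⟨p, q, p, hpq, hpq.symm, by rw [segment_symm ℝ q p, union_self], Or.inl rfl⟩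
  · exact ⟨p, q, r, hpq, hqr, rfl, Or.inr fun h => hc (collinear_of_crs hpq h)⟩

lemma inf_union {S T U : Set (ℝ × ℝ)} (h : ((S ∪ T) ∩ U).Infinite) :
    (S ∩ U).Infinite ∨ (T ∩ U).Infinite := by
  rw [union_inter_distrib_right] at h
  exact infinite_union.1 h

lemma seg_inf_iff {x y z w : ℝ × ℝ} : (segment ℝ x y ∩ segment ℝ z w).Infinite ↔
    (segment ℝ x y ∩ segment ℝ z w).Nontrivial :=
  inf_iff_nontriv (convex_segment _ _) (convex_segment _ _)

lemma path_cases {P : Set (ℝ × ℝ)} (h : IsUn1BendPath P) {a0 a1 b0 b1 : ℝ × ℝ}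
    (ha : (P ∩ segment ℝ a0 a1).Infinite) (hb : (P ∩ segment ℝ b0 b1).Infinite) :
    (∃ x y, x ≠ y ∧ segment ℝ x y ⊆ P ∧ (segment ℝ x y ∩ segment ℝ a0 a1).Nontrivial ∧
      (segment ℝ x y ∩ segment ℝ b0 b1).Nontrivial) ∨
    (∃ p q r, crs (p - q) (r - q) ≠ 0 ∧ segment ℝ q p ⊆ P ∧
      (segment ℝ q p ∩ segment ℝ a0 a1).Nontrivial ∧
      (segment ℝ q r ∩ segment ℝ b0 b1).Nontrivial) := by
  obtain ⟨p, q, r, hpq, hqr, rfl, hc⟩ := path_norm h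
  have hc' : p = r ∨ crs (r - q) (p - q) ≠ 0 := by
    refine hc.imp id fun h h' => h ?_
    simp only [crs] at h' ⊢
    linarith
  have s1 : segment ℝ p q ⊆ segment ℝ p q ∪ segment ℝ q r := subset_union_left
  have s2 : segment ℝ q r ⊆ segment ℝ p q ∪ segment ℝ q r := subset_union_right
  have s1' : segment ℝ q p ⊆ segment ℝ p q ∪ segment ℝ q r := by
    rw [segment_symm ℝ q p]; exact s1
  rcases inf_union ha with na | na <;> rcases inf_union hb with nb | nb <;>
    rw [seg_inf_iff] at na nb
  · exact Or.inl ⟨p, q, hpq, s1, na, nb⟩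
  · rcases hc with rfl | hc
    · rw [segment_symm] at nb
      exact Or.inl ⟨p, q, hpq, s1, na, nb⟩
    · rw [segment_symm] at na
      exact Or.inr ⟨p, q, r, hc, s1', na, nb⟩
  · rcases hc' with rfl | hc
    · rw [segment_symm] at na
      exact Or.inl ⟨p, q, hpq, s1, na, nb⟩
    · rw [segment_symm] at nb
      exact Or.inr ⟨r, q, p, hc, s2, na, nb⟩
  · exact Or.inl ⟨q, r, hqr, s2, na, nb⟩

lemma nontriv_lt {S : Set ℝ} (h : S.Nontrivial) : ∃ u ∈ S, ∃ v ∈ S, u < v := h.exists_lt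

/-- one-dimensional overlap lemma -/
lemma oned {A B I J : Set ℝ} (hA : A.OrdConnected) (hB : B.OrdConnected)
    (hI : I.OrdConnected) (hJ : J.OrdConnected) (hAB : ¬ (A ∩ B).Nontrivial)
    (h1 : (I ∩ A).Nontrivial) (h2 : (I ∩ B).Nontrivial) (h3 : (J ∩ A).Nontrivial)
    (h4 : (J ∩ B).Nontrivial) : (I ∩ J).Nontrivial := by
  -- two overlapping pairs of points witness a nontrivial intersection
  have key : ∀ {S T : Set ℝ}, S.OrdConnected → T.OrdConnected → ∀ {a b c d : ℝ}, a ∈ S → b ∈ S →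
      c ∈ T → d ∈ T → max a c < min b d → (S ∩ T).Nontrivial := by
    intro S T hS hT a b c d ha hb hc hd h
    refine ⟨max a c, ⟨hS.out ha hb ⟨le_max_left _ _, h.le.trans (min_le_left _ _)⟩,
      hT.out hc hd ⟨le_max_right _ _, h.le.trans (min_le_right _ _)⟩⟩, min b d,
      ⟨hS.out ha hb ⟨(le_max_left _ _).trans h.le, (min_le_left _ _)⟩,
      hT.out hc hd ⟨(le_max_right _ _).trans h.le, (min_le_right _ _)⟩⟩, h.ne⟩
  have sep : ∀ {a b c d : ℝ}, a ∈ A → b ∈ A → c ∈ B → d ∈ B → a < b → c < d → b ≤ c ∨ d ≤ a := by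
    intro a b c d ha hb hc hd hab hcd
    by_contra! hh
    exact hAB (key hA hB ha hb hc hd (by simp [hab, hcd, hh.1, hh.2]))
  obtain ⟨a, ⟨aI, aA⟩, b, ⟨bI, bA⟩, ab⟩ := nontriv_lt h1
  obtain ⟨c, ⟨cI, cB⟩, d, ⟨dI, dB⟩, cd⟩ := nontriv_lt h2
  obtain ⟨e, ⟨eJ, eA⟩, f, ⟨fJ, fA⟩, ef⟩ := nontriv_lt h3
  obtain ⟨g, ⟨gJ, gB⟩, k, ⟨kJ, kB⟩, gk⟩ := nontriv_lt h4
  have m1 : min a e ∈ A := by rcases min_choice a e with h | h <;> rw [h] <;> assumption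
  have m2 : max b f ∈ A := by rcases max_choice b f with h | h <;> rw [h] <;> assumption
  have m3 : min c g ∈ B := by rcases min_choice c g with h | h <;> rw [h] <;> assumption
  have m4 : max d k ∈ B := by rcases max_choice d k with h | h <;> rw [h] <;> assumption
  rcases sep m1 m2 m3 m4 (by simp [ab]) (by simp [cd]) with h | h <;>
    simp only [max_le_iff, le_min_iff] at h <;> obtain ⟨⟨h1, h2⟩, h3, h4⟩ := h
  · exact key hI hJ aI dI eJ kJ (by
      simp only [max_lt_iff, lt_min_iff]; refine ⟨⟨?_, ?_⟩, ?_, ?_⟩ <;> linarith)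
  · exact key hI hJ cI bI gJ fJ (by
      simp only [max_lt_iff, lt_min_iff]; refine ⟨⟨?_, ?_⟩, ?_, ?_⟩ <;> linarith)

lemma par_case {a0 a1 b0 b1 x y z w : ℝ × ℝ} (ha : a0 ≠ a1)
    (hab : ¬ (segment ℝ a0 a1 ∩ segment ℝ b0 b1).Nontrivial)
    (h1 : (segment ℝ x y ∩ segment ℝ a0 a1).Nontrivial)
    (h2 : (segment ℝ x y ∩ segment ℝ b0 b1).Nontrivial)
    (h3 : (segment ℝ z w ∩ segment ℝ a0 a1).Nontrivial)
    (h4 : (segment ℝ z w ∩ segment ℝ b0 b1).Nontrivial) :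
    (segment ℝ x y ∩ segment ℝ z w).Nontrivial := by
  let g : ℝ →ᵃ[ℝ] ℝ × ℝ := AffineMap.lineMap a0 a1
  have ginj : Function.Injective g := AffineMap.lineMap_injective ℝ ha
  have oc : ∀ u v : ℝ × ℝ, (g ⁻¹' segment ℝ u v).OrdConnected := fun u v =>
    ((convex_segment u v).affine_preimage g).ordConnected
  have push : ∀ {S T : Set (ℝ × ℝ)}, (g ⁻¹' S ∩ g ⁻¹' T).Nontrivial → (S ∩ T).Nontrivial := by
    rintro S T ⟨m, ⟨m1, m2⟩, n, ⟨n1, n2⟩, hmn⟩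
    exact ⟨g m, ⟨m1, m2⟩, g n, ⟨n1, n2⟩, fun h => hmn (ginj h)⟩
  have pull : ∀ {u v c d : ℝ × ℝ}, (segment ℝ u v ∩ segment ℝ a0 a1).Nontrivial →
      (segment ℝ u v ∩ segment ℝ c d).Nontrivial →
      (g ⁻¹' segment ℝ u v ∩ g ⁻¹' segment ℝ c d).Nontrivial := by
    intro u v c d hu hc
    have onl : ∀ m ∈ segment ℝ u v, ∃ t, g t = m := by
      intro m hm
      rw [inter_comm] at hu
      have := nontriv_line ha hu (left_mem_segment ℝ a0 a1) hm
      obtain ⟨t, ht⟩ := crs_zero (sub_ne_zero.2 ha.symm) this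
      refine ⟨t, ?_⟩
      simp only [g, AffineMap.lineMap_apply, vsub_eq_sub, vadd_eq_add, ← ht]
      abel
    obtain ⟨m, ⟨m1, m2⟩, n, ⟨n1, n2⟩, hmn⟩ := hc
    obtain ⟨t, rfl⟩ := onl m m1
    obtain ⟨s, rfl⟩ := onl n n1
    exact ⟨t, ⟨m1, m2⟩, s, ⟨n1, n2⟩, fun h => hmn (by rw [h])⟩
  exact push (oned (oc a0 a1) (oc b0 b1) (oc x y) (oc z w) (fun h => hab (push h))
    (pull h1 h1) (pull h1 h2) (pull h3 h3) (pull h3 h4))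

lemma ray_overlap {q d : ℝ × ℝ} (hd : d ≠ 0) {s t : ℝ} (h : 0 < s * t) :
    (segment ℝ q (q + s • d) ∩ segment ℝ q (q + t • d)).Nontrivial := by
  have key : ∀ {s t : ℝ}, 0 < s * t → |s| ≤ |t| →
      (segment ℝ q (q + s • d) ∩ segment ℝ q (q + t • d)).Nontrivial := by
    intro s t h hst
    have hs : s ≠ 0 := by rintro rfl; simp at h
    have ht : t ≠ 0 := by rintro rfl; simp at h
    refine ⟨q, ⟨left_mem_segment _ _ _, left_mem_segment _ _ _⟩, q + s • d,
      ⟨right_mem_segment _ _ _, ?_⟩, by simp [hs, hd]⟩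
    rw [segment_eq_image']
    refine ⟨s / t, ⟨?_, ?_⟩, ?_⟩
    · rw [← mul_div_mul_right s t ht]
      exact div_nonneg h.le (mul_self_nonneg t)
    · refine (le_abs_self _).trans ?_
      rw [abs_div]
      exact div_le_one_of_le₀ hst (abs_nonneg _)
    · simp [smul_smul, div_mul_cancel₀ _ ht]
  rcases le_total |s| |t| with h' | h'
  · exact key h h'
  · rw [inter_comm]
    exact key (by linarith) h'

lemma three {a0 a1 b0 b1 : ℝ × ℝ} (ha : a0 ≠ a1) (hb : b0 ≠ b1)
    (hab : ¬ (segment ℝ a0 a1 ∩ segment ℝ b0 b1).Nontrivial) {P : Fin 3 → Set (ℝ × ℝ)}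
    (hP : ∀ i, IsUn1BendPath (P i)) (h1 : ∀ i, (P i ∩ segment ℝ a0 a1).Infinite)
    (h2 : ∀ i, (P i ∩ segment ℝ b0 b1).Infinite) : ∃ i j, i ≠ j ∧ (P i ∩ P j).Infinite := by
  have hc := fun i => path_cases (hP i) (h1 i) (h2 i)
  by_cases hcr : crs (a1 - a0) (b1 - b0) = 0
  · have hc' : ∀ i, ∃ x y, x ≠ y ∧ segment ℝ x y ⊆ P i ∧
        (segment ℝ x y ∩ segment ℝ a0 a1).Nontrivial ∧
        (segment ℝ x y ∩ segment ℝ b0 b1).Nontrivial := by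
      intro i
      refine (hc i).resolve_right ?_
      rintro ⟨p, q, r, hn, -, n1, n2⟩
      rw [inter_comm] at n1 n2
      have e1 := nontriv_line ha n1 (left_mem_segment _ _ _) (left_mem_segment _ _ _)
      have e2 := nontriv_line ha n1 (left_mem_segment _ _ _) (right_mem_segment _ _ _)
      have e3 := nontriv_line hb n2 (left_mem_segment _ _ _) (left_mem_segment _ _ _)
      have e4 := nontriv_line hb n2 (left_mem_segment _ _ _) (right_mem_segment _ _ _)
      obtain ⟨t, ht⟩ := crs_zero (sub_ne_zero.2 ha.symm) hcr
      have ht0 : t ≠ 0 := by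
        rintro rfl
        exact hb (sub_eq_zero.1 (by simpa using ht)).symm
      have f1 : crs (a1 - a0) (p - q) = 0 := by
        simp only [crs, Prod.fst_sub, Prod.snd_sub] at *
        linarith
      have f2 : crs (b1 - b0) (r - q) = 0 := by
        simp only [crs, Prod.fst_sub, Prod.snd_sub] at *
        linarith
      have f3 : crs (a1 - a0) (r - q) = 0 := by
        rw [ht] at f2
        refine (mul_eq_zero.1 (?_ : t * crs (a1 - a0) (r - q) = 0)).resolve_left ht0
        simp only [crs, Prod.smul_fst, Prod.smul_snd, smul_eq_mul] at *
        linarith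
      obtain ⟨s, hs⟩ := crs_zero (sub_ne_zero.2 ha.symm) f1
      obtain ⟨s', hs'⟩ := crs_zero (sub_ne_zero.2 ha.symm) f3
      apply hn
      rw [hs, hs']
      simp only [crs, Prod.smul_fst, Prod.smul_snd, smul_eq_mul]
      ring
    obtain ⟨x, y, hxy, s1, n1, n2⟩ := hc' 0
    obtain ⟨z, w, hzw, s3, n3, n4⟩ := hc' 1
    refine ⟨0, 1, by decide, ?_⟩
    exact (seg_inf_iff.2 (par_case ha hab n1 n2 n3 n4)).mono (inter_subset_inter s1 s3)
  · -- transversal case: all bends are at the intersection of the two lines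
    have hc' : ∀ i, ∃ q : ℝ × ℝ, ∃ t : ℝ, t ≠ 0 ∧ segment ℝ q (q + t • (a1 - a0)) ⊆ P i ∧
        crs (a1 - a0) (q - a0) = 0 ∧ crs (b1 - b0) (q - b0) = 0 := by
      intro i
      rcases hc i with ⟨x, y, hxy, -, n1, n2⟩ | ⟨p, q, r, hn, hs, n1, n2⟩
      · exfalso
        have e1 := nontriv_line hxy n1 (left_mem_segment _ _ _) (left_mem_segment _ _ _)
        have e2 := nontriv_line hxy n1 (left_mem_segment _ _ _) (right_mem_segment _ _ _)
        have e3 := nontriv_line hxy n2 (left_mem_segment _ _ _) (left_mem_segment _ _ _)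
        have e4 := nontriv_line hxy n2 (left_mem_segment _ _ _) (right_mem_segment _ _ _)
        have f1 : crs (y - x) (a1 - a0) = 0 := by
          simp only [crs, Prod.fst_sub, Prod.snd_sub] at *
          linarith
        have f2 : crs (y - x) (b1 - b0) = 0 := by
          simp only [crs, Prod.fst_sub, Prod.snd_sub] at *
          linarith
        obtain ⟨s, hs⟩ := crs_zero (sub_ne_zero.2 hxy.symm) f1
        obtain ⟨s', hs'⟩ := crs_zero (sub_ne_zero.2 hxy.symm) f2
        apply hcr
        rw [hs, hs']
        simp only [crs, Prod.smul_fst, Prod.smul_snd, smul_eq_mul]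
        ring
      · rw [inter_comm] at n1 n2
        have e1 := nontriv_line ha n1 (left_mem_segment _ _ _) (left_mem_segment _ _ _)
        have e2 := nontriv_line ha n1 (left_mem_segment _ _ _) (right_mem_segment _ _ _)
        have e3 := nontriv_line hb n2 (left_mem_segment _ _ _) (left_mem_segment _ _ _)
        have f1 : crs (a1 - a0) (p - q) = 0 := by
          simp only [crs, Prod.fst_sub, Prod.snd_sub] at *
          linarith
        obtain ⟨t, ht⟩ := crs_zero (sub_ne_zero.2 ha.symm) f1
        refine ⟨q, t, ?_, ?_, e1, e3⟩
        · rintro rfl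
          apply hn
          rw [ht]
          simp [crs]
        · rw [← ht]
          simpa using hs
    choose q t ht hs e1 e2 using hc'
    have hq : ∀ i j, q i = q j := by
      intro i j
      have f1 : crs (a1 - a0) (q i - q j) = 0 := by
        have := e1 i
        have := e1 j
        simp only [crs, Prod.fst_sub, Prod.snd_sub] at *
        linarith
      have f2 : crs (b1 - b0) (q i - q j) = 0 := by
        have := e2 i
        have := e2 j
        simp only [crs, Prod.fst_sub, Prod.snd_sub] at *
        linarith
      obtain ⟨s, h⟩ := crs_zero (sub_ne_zero.2 ha.symm) f1
      rw [h] at f2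
      have : s * crs (a1 - a0) (b1 - b0) = 0 := by
        simp only [crs, Prod.smul_fst, Prod.smul_snd, smul_eq_mul] at *
        linarith
      have hs0 := (mul_eq_zero.1 this).resolve_right hcr
      rw [hs0, zero_smul] at h
      exact sub_eq_zero.1 h
    have fin : ∀ i j, i ≠ j → 0 < t i * t j → ∃ i j, i ≠ j ∧ (P i ∩ P j).Infinite := by
      intro i j hij h
      refine ⟨i, j, hij, ?_⟩
      have hj := hs j
      rw [hq j i] at hj
      exact (seg_inf_iff.2 (ray_overlap (sub_ne_zero.2 ha.symm) h)).mono
        (inter_subset_inter (hs i) hj)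
    rcases lt_or_gt_of_ne (ht 0) with h0 | h0 <;> rcases lt_or_gt_of_ne (ht 1) with h1 | h1 <;>
      rcases lt_or_gt_of_ne (ht 2) with h2 | h2 <;>
    first
    | exact fin 0 1 (by decide) (mul_pos h0 h1)
    | exact fin 0 1 (by decide) (mul_pos_of_neg_of_neg h0 h1)
    | exact fin 0 2 (by decide) (mul_pos h0 h2)
    | exact fin 0 2 (by decide) (mul_pos_of_neg_of_neg h0 h2)
    | exact fin 1 2 (by decide) (mul_pos h1 h2)
    | exact fin 1 2 (by decide) (mul_pos_of_neg_of_neg h1 h2)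

/-- the two legs of a path, indexed by `Fin 2` -/
lemma path_legs {P : Set (ℝ × ℝ)} (h : IsUn1BendPath P) :
    ∃ x y : Fin 2 → ℝ × ℝ, (∀ i, x i ≠ y i) ∧ (∀ i, segment ℝ (x i) (y i) ⊆ P) ∧
      ∀ Q : Set (ℝ × ℝ), (P ∩ Q).Infinite → ∃ i, (Q ∩ segment ℝ (x i) (y i)).Infinite := by
  obtain ⟨p, q, r, hpq, hqr, rfl, -⟩ := path_norm h
  refine ⟨![p, q], ![q, r], ?_, ?_, ?_⟩
  · intro i
    fin_cases i
    · exact hpq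
    · exact hqr
  · intro i
    fin_cases i
    · exact subset_union_left
    · exact subset_union_right
  · intro Q hQ
    rcases inf_union hQ with h | h <;> rw [inter_comm] at h
    · exact ⟨0, h⟩
    · exact ⟨1, h⟩

lemma upper {s : ℕ} {f : Fin 2 ⊕ Fin s → Set (ℝ × ℝ)}
    (hf : IsUn1BendEPG (completeBipartiteGraph (Fin 2) (Fin s)) f) : s ≤ 8 := by
  obtain ⟨hp, hadj⟩ := hf
  by_contra! hs
  obtain ⟨ax, ay, an, asub, acov⟩ := path_legs (hp (Sum.inl 0))
  obtain ⟨bx, bIy, bn, bsub, bcov⟩ := path_legs (hp (Sum.inl 1))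
  have hA : ∀ i : Fin s, ∃ k, (f (Sum.inr i) ∩ segment ℝ (ax k) (ay k)).Infinite := fun i =>
    acov _ ((hadj (Sum.inl 0) (Sum.inr i) (by simp)).1 (by simp))
  have hB : ∀ i : Fin s, ∃ k, (f (Sum.inr i) ∩ segment ℝ (bx k) (bIy k)).Infinite := fun i =>
    bcov _ ((hadj (Sum.inl 1) (Sum.inr i) (by simp)).1 (by simp))
  choose k hk using hA
  choose l hl using hB
  obtain ⟨⟨c, d⟩, -, hcd⟩ := Finset.exists_lt_card_fiber_of_mul_lt_card_of_maps_to
    (s := (Finset.univ : Finset (Fin s))) (t := (Finset.univ : Finset (Fin 2 × Fin 2)))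
    (f := fun i => (k i, l i)) (n := 2) (fun _ _ => Finset.mem_univ _) (by simpa using hs)
  obtain ⟨x, y, z, hx, hy, hz, hxy, hxz, hyz⟩ := Finset.two_lt_card_iff.1 hcd
  simp only [Finset.mem_filter, Finset.mem_univ, true_and, Prod.mk.injEq] at hx hy hz
  let e : Fin 3 → Fin s := ![x, y, z]
  have he : ∀ i, k (e i) = c ∧ l (e i) = d := by
    intro i
    fin_cases i
    · exact hx
    · exact hy
    · exact hz
  have hinj : ∀ i j, i ≠ j → e i ≠ e j := by
    intro i j hij
    fin_cases i <;> fin_cases j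
    · exact absurd rfl hij
    · exact hxy
    · exact hxz
    · exact hxy.symm
    · exact absurd rfl hij
    · exact hyz
    · exact hxz.symm
    · exact hyz.symm
    · exact absurd rfl hij
  have hab : ¬ (segment ℝ (ax c) (ay c) ∩ segment ℝ (bx d) (bIy d)).Nontrivial := by
    intro h
    have := (seg_inf_iff.2 h).mono (inter_subset_inter (asub c) (bsub d))
    have := (hadj (Sum.inl 0) (Sum.inl 1) (by simp)).2 this
    simp at this
  obtain ⟨i, j, hij, hinf⟩ := three (an c) (bn d) hab (P := fun i => f (Sum.inr (e i)))
    (fun i => hp _) (fun i => by have := hk (e i); rwa [(he i).1] at this)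
    (fun i => by have := hl (e i); rwa [(he i).2] at this)
  have := (hadj (Sum.inr (e i)) (Sum.inr (e j)) (by simpa using hinj i j hij)).2 hinf
  simp at this

/-! ### The construction for `s = 8` -/

/-- endpoint, bend, endpoint of each path -/
def coords : Fin 2 ⊕ Fin 8 → (ℤ × ℤ) × (ℤ × ℤ) × (ℤ × ℤ)
  | Sum.inl i => ![((30, 0), (0, 0), (20, 20)), ((30, -6), (6, 18), (13, -3))] i
  | Sum.inr i => ![((25, 0), (24, 0), (25, -1)), ((23, 0), (24, 0), (23, 1)),
      ((13, 13), (12, 12), (13, 11)), ((11, 11), (12, 12), (11, 13)),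
      ((10, 10), (9, 9), (10, 6)), ((8, 8), (9, 9), (8, 12)),
      ((13, 0), (12, 0), (13, -3)), ((11, 0), (12, 0), (11, 3))] i

/-- integer point as a real point -/
def rp (p : ℤ × ℤ) : ℝ × ℝ := (p.1, p.2)

/-- criterion for two segments to meet in at most one point -/
def FinChk (p q r s : ℤ × ℤ) : Prop :=
  crs (q - p) (s - r) ≠ 0 ∨ crs (q - p) (r - p) ≠ 0 ∨
    (p.1 ≠ q.1 ∧ (max p.1 q.1 ≤ min r.1 s.1 ∨ max r.1 s.1 ≤ min p.1 q.1))

instance (p q r s : ℤ × ℤ) : Decidable (FinChk p q r s) := by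
  unfold FinChk; infer_instance

/-- criterion for a point to lie on a segment -/
def MemChk (p r s : ℤ × ℤ) : Prop :=
  crs (s - r) (p - r) = 0 ∧ r.1 ≠ s.1 ∧ min r.1 s.1 ≤ p.1 ∧ p.1 ≤ max r.1 s.1

instance (p r s : ℤ × ℤ) : Decidable (MemChk p r s) := by
  unfold MemChk; infer_instance

lemma rp_inj {p q : ℤ × ℤ} (h : rp p = rp q) : p = q := by
  simp only [rp, Prod.mk.injEq, Int.cast_inj] at h
  exact Prod.ext h.1 h.2

lemma crs_rp (p q r s : ℤ × ℤ) :
    crs (rp q - rp p) (rp s - rp r) = ((crs (q - p) (s - r) : ℤ) : ℝ) := by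
  simp [crs, rp]

lemma seg_fst_bounds {x y u : ℝ × ℝ} (h : u ∈ segment ℝ x y) :
    min x.1 y.1 ≤ u.1 ∧ u.1 ≤ max x.1 y.1 := by
  obtain ⟨t, h0, h1, e, -⟩ := mem_seg h
  rw [e]
  rcases le_total x.1 y.1 with h | h
  · rw [min_eq_left h, max_eq_right h]
    constructor <;> nlinarith
  · rw [min_eq_right h, max_eq_left h]
    constructor <;> nlinarith

lemma fin_of_chk {p q r s : ℤ × ℤ} (hpq : p ≠ q) (h : FinChk p q r s) :
    ¬ (segment ℝ (rp p) (rp q) ∩ segment ℝ (rp r) (rp s)).Infinite := by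
  rw [seg_inf_iff]
  intro hn
  have hpq' : rp p ≠ rp q := fun h => hpq (rp_inj h)
  have e1 := nontriv_line hpq' hn (left_mem_segment _ _ _) (left_mem_segment _ _ _)
  have e2 := nontriv_line hpq' hn (left_mem_segment _ _ _) (right_mem_segment _ _ _)
  rw [crs_rp] at e1 e2
  have e1' : crs (q - p) (r - p) = 0 := by exact_mod_cast e1
  have e2' : crs (q - p) (s - p) = 0 := by exact_mod_cast e2
  rcases h with h | h | ⟨hne, h⟩
  · apply h
    simp only [crs, Prod.fst_sub, Prod.snd_sub] at *
    linarith
  · exact h e1'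
  · obtain ⟨m, ⟨m1, m2⟩, n, ⟨n1, n2⟩, hmn⟩ := hn
    have hf : m.1 = n.1 := by
      have a1 := seg_fst_bounds m1
      have a2 := seg_fst_bounds m2
      have a3 := seg_fst_bounds n1
      have a4 := seg_fst_bounds n2
      simp only [rp] at a1 a2 a3 a4
      rcases h with h | h
      · have h' : max (p.1 : ℝ) q.1 ≤ min (r.1 : ℝ) s.1 := by exact_mod_cast h
        linarith [a1.2, a2.1, a3.2, a4.1, a1.1, a2.2, a3.1, a4.2]
      · have h' : max (r.1 : ℝ) s.1 ≤ min (p.1 : ℝ) q.1 := by exact_mod_cast h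
        linarith [a1.2, a2.1, a3.2, a4.1, a1.1, a2.2, a3.1, a4.2]
    have hl := seg_line (left_mem_segment ℝ (rp p) (rp q)) (right_mem_segment _ _ _) m1 n1
    apply hmn
    refine Prod.ext hf ?_
    have hne' : ((q.1 : ℝ) - p.1) ≠ 0 := by
      rw [sub_ne_zero]
      exact_mod_cast hne.symm
    simp only [crs, Prod.fst_sub, Prod.snd_sub, rp, hf, sub_self, mul_zero, sub_zero] at hl
    exact sub_eq_zero.1 ((mul_eq_zero.1 hl).resolve_left hne')

lemma mem_of_chk {p r s : ℤ × ℤ} (h : MemChk p r s) : rp p ∈ segment ℝ (rp r) (rp s) := by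
  have key : ∀ {r s : ℤ × ℤ}, crs (s - r) (p - r) = 0 → r.1 < s.1 → r.1 ≤ p.1 → p.1 ≤ s.1 →
      rp p ∈ segment ℝ (rp r) (rp s) := by
    intro r s hc hlt h1 h2
    rw [segment_eq_image']
    have hlt' : (0 : ℝ) < (s.1 : ℝ) - r.1 := by
      rw [sub_pos]; exact_mod_cast hlt
    have h1' : (r.1 : ℝ) ≤ p.1 := by exact_mod_cast h1
    have h2' : (p.1 : ℝ) ≤ s.1 := by exact_mod_cast h2
    have hc' : ((crs (s - r) (p - r) : ℤ) : ℝ) = 0 := by rw [hc]; simp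
    rw [← crs_rp] at hc'
    simp only [crs, rp, Prod.fst_sub, Prod.snd_sub] at hc'
    refine ⟨((p.1 : ℝ) - r.1) / (s.1 - r.1), ⟨div_nonneg (by linarith) hlt'.le,
      div_le_one_of_le₀ (by linarith) hlt'.le⟩, ?_⟩
    ext
    · simp only [rp, Prod.fst_add, Prod.smul_fst, Prod.fst_sub, smul_eq_mul]
      field_simp
      ring
    · simp only [rp, Prod.snd_add, Prod.smul_snd, Prod.snd_sub, smul_eq_mul]
      field_simp
      linarith
  obtain ⟨hc, hne, h1, h2⟩ := h
  rcases lt_or_gt_of_ne hne with hlt | hlt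
  · exact key hc hlt (by omega) (by omega)
  · rw [segment_symm]
    refine key ?_ hlt (by omega) (by omega)
    simp only [crs, Prod.fst_sub, Prod.snd_sub] at *
    linarith

/-- criterion for overlap of the path of `v` with the path of `u` -/
def InfChk (u v : Fin 2 ⊕ Fin 8) : Prop :=
  let a := coords u
  let c := coords v
  (MemChk c.1 a.1 a.2.1 ∧ MemChk c.2.1 a.1 a.2.1) ∨
  (MemChk c.1 a.2.1 a.2.2 ∧ MemChk c.2.1 a.2.1 a.2.2) ∨
  (MemChk c.2.1 a.1 a.2.1 ∧ MemChk c.2.2 a.1 a.2.1) ∨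
  (MemChk c.2.1 a.2.1 a.2.2 ∧ MemChk c.2.2 a.2.1 a.2.2)

instance (u v : Fin 2 ⊕ Fin 8) : Decidable (InfChk u v) := by
  unfold InfChk; infer_instance

/-- criterion for the paths of `u` and `v` not to overlap -/
def NoChk (u v : Fin 2 ⊕ Fin 8) : Prop :=
  let a := coords u
  let c := coords v
  FinChk a.1 a.2.1 c.1 c.2.1 ∧ FinChk a.1 a.2.1 c.2.1 c.2.2 ∧
  FinChk a.2.1 a.2.2 c.1 c.2.1 ∧ FinChk a.2.1 a.2.2 c.2.1 c.2.2

instance (u v : Fin 2 ⊕ Fin 8) : Decidable (NoChk u v) := by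
  unfold NoChk; infer_instance

/-- the representation of `K_{2,8}` -/
def rep (v : Fin 2 ⊕ Fin 8) : Set (ℝ × ℝ) :=
  segment ℝ (rp (coords v).1) (rp (coords v).2.1) ∪
    segment ℝ (rp (coords v).2.1) (rp (coords v).2.2)

lemma coords_ok : ∀ v, (coords v).1 ≠ (coords v).2.1 ∧ (coords v).2.1 ≠ (coords v).2.2 ∧
    crs ((coords v).1 - (coords v).2.1) ((coords v).2.2 - (coords v).2.1) ≠ 0 := by
  decide +kernel

lemma inf_ok : ∀ (i : Fin 2) (j : Fin 8), InfChk (Sum.inl i) (Sum.inr j) := by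
  decide +kernel

lemma no_ok : (∀ i j : Fin 2, i ≠ j → NoChk (Sum.inl i) (Sum.inl j)) ∧
    ∀ i j : Fin 8, i ≠ j → NoChk (Sum.inr i) (Sum.inr j) := by
  decide +kernel

lemma rep_inf {u v : Fin 2 ⊕ Fin 8} (h : InfChk u v) : (rep u ∩ rep v).Infinite := by
  have key : ∀ {p q r s : ℤ × ℤ}, p ≠ q → MemChk p r s → MemChk q r s →
      (segment ℝ (rp r) (rp s) ∩ segment ℝ (rp p) (rp q)).Infinite := by
    intro p q r s hpq h1 h2
    exact seg_inf_iff.2 ⟨rp p, ⟨mem_of_chk h1, left_mem_segment _ _ _⟩, rp q,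
      ⟨mem_of_chk h2, right_mem_segment _ _ _⟩, fun h => hpq (rp_inj h)⟩
  obtain ⟨h1, h2, -⟩ := coords_ok v
  rcases h with h | h | h | h
  · exact (key h1 h.1 h.2).mono (inter_subset_inter subset_union_left subset_union_left)
  · exact (key h1 h.1 h.2).mono (inter_subset_inter subset_union_right subset_union_left)
  · exact (key h2 h.1 h.2).mono (inter_subset_inter subset_union_left subset_union_right)
  · exact (key h2 h.1 h.2).mono (inter_subset_inter subset_union_right subset_union_right)

lemma rep_no {u v : Fin 2 ⊕ Fin 8} (h : NoChk u v) : ¬ (rep u ∩ rep v).Infinite := by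
  obtain ⟨h1, h2, -⟩ := coords_ok u
  obtain ⟨a, b, c, d⟩ := h
  intro hi
  rcases inf_union hi with hi | hi <;> rw [inter_comm] at hi <;>
    rcases inf_union hi with hi | hi <;> rw [inter_comm] at hi
  · exact fin_of_chk h1 a hi
  · exact fin_of_chk h1 b hi
  · exact fin_of_chk h2 c hi
  · exact fin_of_chk h2 d hi

lemma rep_path (v : Fin 2 ⊕ Fin 8) : IsUn1BendPath (rep v) := by
  obtain ⟨h1, h2, h3⟩ := coords_ok v
  refine Or.inr ⟨_, _, _, fun h => h1 (rp_inj h), fun h => h2 (rp_inj h), fun h => h3 ?_, rfl⟩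
  have := crs_of_collinear h
  rw [crs_rp] at this
  exact_mod_cast this

lemma rep_epg : IsUn1BendEPG (completeBipartiteGraph (Fin 2) (Fin 8)) rep := by
  refine ⟨rep_path, ?_⟩
  rintro (i | i) (j | j) hij
  · simpa using rep_no (no_ok.1 i j (by simpa using hij))
  · simpa using rep_inf (inf_ok i j)
  · rw [inter_comm]
    simpa using rep_inf (inf_ok j i)
  · simpa using rep_no (no_ok.2 i j (by simpa using hij))

/-- The complete bipartite graph `K_{2,s}` admits an unaligned 1-bend EPG
representation if and only if `s ≤ 8`. -/
theorem stmt12 (s : ℕ) (hs : 0 < s) :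
    (∃ f : Fin 2 ⊕ Fin s → Set (ℝ × ℝ),
      IsUn1BendEPG (completeBipartiteGraph (Fin 2) (Fin s)) f) ↔ s ≤ 8 := by
  constructor
  · rintro ⟨f, hf⟩
    exact upper hf
  · intro h
    refine ⟨fun v => rep (Sum.map id (Fin.castLE h) v), fun v => rep_path _, ?_⟩
    intro u v huv
    have hne : Sum.map id (Fin.castLE h) u ≠ Sum.map id (Fin.castLE h) v := fun e =>
      huv (Function.Injective.sumMap Function.injective_id (Fin.castLE_injective h) e)
    rw [← rep_epg.2 _ _ hne]
    cases u <;> cases v <;> simp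
end
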